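/- arXiv:2404.13072 — 3 statements merged into one kernel-verified Lean document; each statement's English description precedes it below -/
import Mathlib

section
/- Let X be a real Banach space, φ : X → ℝ and V : X → X locally Lipschitz, and suppose ⟨x*, V(x)⟩ ≥ 0 for every x ∈ X and every x* ∈ ∂φ(x). If σ : [0,T) → X is a solution of σ' = −V(σ), then the function t ↦ φ(σ(t)) is non-increasing on [0,T). (Lemma 2.4, part 3) -/
open Filter Topology Set

noncomputable section

variable {X : Type*} [NormedAddCommGroup X] [NormedSpace ℝ X]

/-- Clarke generalized directional derivative of a locally Lipschitz functional. -/
def clarkeDeriv (φ : X → ℝ) (x h : X) : ℝ :=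
  Filter.limsup (fun p : X × ℝ => (φ (p.1 + p.2 • h) - φ p.1) / p.2)
    ((𝓝 x) ×ˢ (𝓝[>] (0 : ℝ)))

/-- Clarke subdifferential. -/
def clarkeSubdiff (φ : X → ℝ) (x : X) : Set (X →L[ℝ] ℝ) :=
  {xs | ∀ h : X, xs h ≤ clarkeDeriv φ x h}

/-- The points `p.1 + p.2 • h` tend to `x` as `p.1 → x` and `p.2 ↓ 0`. -/
theorem tendsto_add_smul_nhds_prod_nhdsGT (x h : X) :
    Tendsto (fun p : X × ℝ => p.1 + p.2 • h) ((𝓝 x) ×ˢ (𝓝[>] (0 : ℝ))) (𝓝 x) := by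
  have hsnd : Tendsto (fun p : X × ℝ => p.2) ((𝓝 x) ×ˢ (𝓝[>] (0 : ℝ))) (𝓝 0) :=
    tendsto_snd.mono_right nhdsWithin_le_nhds
  simpa using tendsto_fst.add (hsnd.smul_const h)

theorem eventually_nhds_prod_nhdsGT_pos {Y : Type*} [TopologicalSpace Y] (x : Y) :
    ∀ᶠ p : Y × ℝ in (𝓝 x) ×ˢ (𝓝[>] (0 : ℝ)), 0 < p.2 :=
  tendsto_snd.eventually self_mem_nhdsWithin

/-- Near `x`, the difference quotients of a locally Lipschitz function are bounded by a multiple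
of the length of the direction. -/
theorem LocallyLipschitz.exists_eventually_abs_div_le {φ : X → ℝ} (hφ : LocallyLipschitz φ)
    (x : X) : ∃ K : ℝ, ∀ h : X, ∀ᶠ p : X × ℝ in (𝓝 x) ×ˢ (𝓝[>] (0 : ℝ)),
      |(φ (p.1 + p.2 • h) - φ p.1) / p.2| ≤ K * ‖h‖ := by
  obtain ⟨K, u, hu, hK⟩ := hφ x
  refine ⟨K, fun h => ?_⟩
  filter_upwards [(tendsto_add_smul_nhds_prod_nhdsGT x h).eventually hu,
    tendsto_fst.eventually hu, eventually_nhds_prod_nhdsGT_pos x] with p h₁ h₂ hp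
  have hd := hK.dist_le_mul _ h₁ _ h₂
  rw [Real.dist_eq, dist_eq_norm, add_sub_cancel_left, norm_smul, Real.norm_of_nonneg hp.le] at hd
  rw [abs_div, abs_of_pos hp, div_le_iff₀ hp]
  linarith

theorem eventually_lt_of_clarkeDeriv_lt {φ : X → ℝ} (hφ : LocallyLipschitz φ) {x h : X} {r : ℝ}
    (hr : clarkeDeriv φ x h < r) : ∀ᶠ p : X × ℝ in (𝓝 x) ×ˢ (𝓝[>] (0 : ℝ)),
      (φ (p.1 + p.2 • h) - φ p.1) / p.2 < r := by
  obtain ⟨K, hK⟩ := hφ.exists_eventually_abs_div_le x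
  exact eventually_lt_of_limsup_lt hr
    ⟨K * ‖h‖, eventually_map.2 ((hK h).mono fun p hp => (abs_le.1 hp).2)⟩

theorem clarkeDeriv_le_of_eventually_le {φ : X → ℝ} (hφ : LocallyLipschitz φ) {x h : X} {r : ℝ}
    (hr : ∀ᶠ p : X × ℝ in (𝓝 x) ×ˢ (𝓝[>] (0 : ℝ)), (φ (p.1 + p.2 • h) - φ p.1) / p.2 ≤ r) :
    clarkeDeriv φ x h ≤ r := by
  obtain ⟨K, hK⟩ := hφ.exists_eventually_abs_div_le x
  have hb : IsBoundedUnder (· ≥ ·) ((𝓝 x) ×ˢ (𝓝[>] (0 : ℝ)))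
      (fun p : X × ℝ => (φ (p.1 + p.2 • h) - φ p.1) / p.2) :=
    ⟨-(K * ‖h‖), eventually_map.2 ((hK h).mono fun p hp => (abs_le.1 hp).1)⟩
  exact limsup_le_of_le hb.isCoboundedUnder_flip hr

theorem exists_clarkeDeriv_le_mul_norm {φ : X → ℝ} (hφ : LocallyLipschitz φ) (x : X) :
    ∃ K : ℝ, ∀ h : X, clarkeDeriv φ x h ≤ K * ‖h‖ := by
  obtain ⟨K, hK⟩ := hφ.exists_eventually_abs_div_le x
  exact ⟨K, fun h => clarkeDeriv_le_of_eventually_le hφ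
    ((hK h).mono fun p hp => (abs_le.1 hp).2)⟩

@[simp]
theorem clarkeDeriv_zero (φ : X → ℝ) (x : X) : clarkeDeriv φ x 0 = 0 := by
  simp [clarkeDeriv]

theorem clarkeDeriv_add_le {φ : X → ℝ} (hφ : LocallyLipschitz φ) (x h k : X) :
    clarkeDeriv φ x (h + k) ≤ clarkeDeriv φ x h + clarkeDeriv φ x k := by
  refine le_of_forall_pos_le_add fun ε hε => clarkeDeriv_le_of_eventually_le hφ ?_
  have hh := eventually_lt_of_clarkeDeriv_lt hφ
    (show clarkeDeriv φ x h < clarkeDeriv φ x h + ε / 2 by linarith)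
  have hk := ((tendsto_add_smul_nhds_prod_nhdsGT x h).prodMk tendsto_snd).eventually
    (eventually_lt_of_clarkeDeriv_lt hφ
      (show clarkeDeriv φ x k < clarkeDeriv φ x k + ε / 2 by linarith))
  filter_upwards [hh, hk] with p h₁ h₂
  have hsplit : (φ (p.1 + p.2 • (h + k)) - φ p.1) / p.2 =
      (φ (p.1 + p.2 • h + p.2 • k) - φ (p.1 + p.2 • h)) / p.2 +
        (φ (p.1 + p.2 • h) - φ p.1) / p.2 := by
    rw [smul_add, add_assoc]
    ring
  rw [hsplit]
  linarith

theorem clarkeDeriv_smul_le {φ : X → ℝ} (hφ : LocallyLipschitz φ) (x h : X) {c : ℝ}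
    (hc : 0 < c) : clarkeDeriv φ x (c • h) ≤ c * clarkeDeriv φ x h := by
  refine le_of_forall_pos_le_add fun ε hε => clarkeDeriv_le_of_eventually_le hφ ?_
  have hmul : Tendsto (fun p : X × ℝ => c * p.2) ((𝓝 x) ×ˢ (𝓝[>] (0 : ℝ))) (𝓝[>] 0) := by
    refine tendsto_nhdsWithin_iff.2 ⟨?_, ?_⟩
    · have hsnd : Tendsto (fun p : X × ℝ => p.2) ((𝓝 x) ×ˢ (𝓝[>] (0 : ℝ))) (𝓝 0) :=
        tendsto_snd.mono_right nhdsWithin_le_nhds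
      simpa using hsnd.const_mul c
    · exact (eventually_nhds_prod_nhdsGT_pos x).mono fun p hp => mul_pos hc hp
  have hh := (tendsto_fst.prodMk hmul).eventually (eventually_lt_of_clarkeDeriv_lt hφ
    (show clarkeDeriv φ x h < clarkeDeriv φ x h + ε / c by linarith [div_pos hε hc]))
  filter_upwards [hh, eventually_nhds_prod_nhdsGT_pos x] with p h₁ hp
  have hscale : (φ (p.1 + p.2 • c • h) - φ p.1) / p.2 =
      c * ((φ (p.1 + (c * p.2) • h) - φ p.1) / (c * p.2)) := by
    rw [smul_smul, mul_comm p.2 c]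
    field_simp
  rw [hscale]
  calc _ ≤ c * (clarkeDeriv φ x h + ε / c) := mul_le_mul_of_nonneg_left h₁.le hc.le
    _ = _ := by field_simp

theorem clarkeDeriv_smul {φ : X → ℝ} (hφ : LocallyLipschitz φ) (x h : X) {c : ℝ}
    (hc : 0 < c) : clarkeDeriv φ x (c • h) = c * clarkeDeriv φ x h := by
  refine (clarkeDeriv_smul_le hφ x h hc).antisymm ?_
  have hinv := clarkeDeriv_smul_le hφ x (c • h) (inv_pos.2 hc)
  rwa [inv_smul_smul₀ hc.ne', ← div_eq_inv_mul, le_div_iff₀' hc] at hinv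

/-- The generalized directional derivative in a direction is attained by an element of the Clarke
subdifferential. -/
theorem exists_mem_clarkeSubdiff_apply_eq {φ : X → ℝ} (hφ : LocallyLipschitz φ) (x h : X) :
    ∃ xs ∈ clarkeSubdiff φ x, xs h = clarkeDeriv φ x h := by
  have hspan : ∀ c : ℝ, c * clarkeDeriv φ x h ≤ clarkeDeriv φ x (c • h) := by
    intro c
    rcases lt_trichotomy c 0 with hc | rfl | hc
    · have hneg := clarkeDeriv_smul hφ x h (neg_pos.2 hc)
      have hadd := clarkeDeriv_add_le hφ x (c • h) (-c • h)
      rw [← add_smul, add_neg_cancel, zero_smul, clarkeDeriv_zero, hneg] at hadd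
      linarith
    · simp
    · exact (clarkeDeriv_smul hφ x h hc).ge
  have hwd : ∀ c : ℝ, c • h = 0 → (RingHom.id ℝ) c • clarkeDeriv φ x h = 0 := by
    intro c hc
    rcases smul_eq_zero.1 hc with rfl | rfl <;> simp
  obtain ⟨g, hg, hle⟩ := exists_extension_of_le_sublinear
    (LinearPMap.mkSpanSingleton' h (clarkeDeriv φ x h) hwd) (clarkeDeriv φ x)
    (fun c hc y => clarkeDeriv_smul hφ x y hc) (clarkeDeriv_add_le hφ x) (by
      rintro ⟨y, hy⟩
      obtain ⟨c, rfl⟩ := Submodule.mem_span_singleton.1 hy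
      rw [LinearPMap.mkSpanSingleton'_apply]
      exact hspan c)
  obtain ⟨K, hK⟩ := exists_clarkeDeriv_le_mul_norm hφ x
  refine ⟨g.mkContinuous K fun y => ?_, hle, ?_⟩
  · rw [Real.norm_eq_abs, abs_le]
    have hneg := (hle (-y)).trans (hK (-y))
    rw [map_neg, norm_neg] at hneg
    exact ⟨by linarith, (hle y).trans (hK y)⟩
  · have hmem : (1 : ℝ) • h ∈ (LinearPMap.mkSpanSingleton' h (clarkeDeriv φ x h) hwd).domain :=
      Submodule.mem_span_singleton.2 ⟨1, rfl⟩
    have hgh := hg ⟨(1 : ℝ) • h, hmem⟩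
    rw [LinearPMap.mkSpanSingleton'_apply] at hgh
    simpa using hgh

/-- Along a differentiable curve, the upper right Dini derivative of `φ` is at most the
generalized directional derivative in the direction of the velocity. -/
theorem HasDerivAt.eventually_slope_lt_of_clarkeDeriv_lt {φ : X → ℝ} (hφ : LocallyLipschitz φ)
    {σ : ℝ → X} {v : X} {t r : ℝ} (hσ : HasDerivAt σ v t) (hr : clarkeDeriv φ (σ t) v < r) :
    ∀ᶠ z in 𝓝[>] t, slope (φ ∘ σ) t z < r := by
  obtain ⟨m, hm, hmr⟩ := exists_between hr
  obtain ⟨K, u, hu, hK⟩ := hφ (σ t)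
  have hsub : Tendsto (fun z : ℝ => z - t) (𝓝[>] t) (𝓝[>] 0) := by
    refine tendsto_nhdsWithin_iff.2 ⟨?_, ?_⟩
    · have hc : Continuous fun z : ℝ => z - t := by fun_prop
      simpa using (hc.tendsto t).mono_left nhdsWithin_le_nhds
    · filter_upwards [self_mem_nhdsWithin] with z hz using sub_pos.2 (mem_Ioi.1 hz)
  have hpair : Tendsto (fun z : ℝ => (σ t, z - t)) (𝓝[>] t) ((𝓝 (σ t)) ×ˢ (𝓝[>] (0 : ℝ))) :=
    tendsto_const_nhds.prodMk hsub
  have hε : 0 < (r - m) / (K + 1) := div_pos (sub_pos.2 hmr) (by positivity)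
  filter_upwards [hpair.eventually (eventually_lt_of_clarkeDeriv_lt hφ hm),
    hpair.eventually ((tendsto_add_smul_nhds_prod_nhdsGT (σ t) v).eventually hu),
    nhdsWithin_le_nhds (hσ.continuousAt.eventually hu),
    nhdsWithin_le_nhds ((hasDerivAt_iff_isLittleO.1 hσ).bound hε),
    self_mem_nhdsWithin] with z hlt hlin hz herr htz
  have hpos : 0 < z - t := sub_pos.2 htz
  rw [Real.norm_of_nonneg hpos.le] at herr
  have hprod : K * ((r - m) / (K + 1)) ≤ r - m := by
    rw [← mul_div_assoc, div_le_iff₀ (by positivity)]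
    nlinarith [K.coe_nonneg]
  have hd' : φ (σ z) - φ (σ t + (z - t) • v) ≤ (r - m) * (z - t) :=
    calc _ ≤ K * ((r - m) / (K + 1) * (z - t)) :=
          (le_abs_self _).trans ((hK.dist_le_mul _ hz _ hlin).trans (by
            rw [dist_eq_norm, ← sub_sub]
            exact mul_le_mul_of_nonneg_left herr K.coe_nonneg))
      _ = K * ((r - m) / (K + 1)) * (z - t) := by ring
      _ ≤ _ := mul_le_mul_of_nonneg_right hprod hpos.le
  rw [div_lt_iff₀ hpos] at hlt
  rw [slope_def_field, div_lt_iff₀ hpos]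
  simp only [Function.comp_apply]
  linarith

/-- **Lemma 2.4, part 3.** If `⟨x*, V(x)⟩ ≥ 0` for all `x* ∈ ∂φ(x)`, then `φ` is
non-increasing along solutions of `σ' = -V(σ)`. -/
theorem lemma_2_4_part3
    {X : Type*} [NormedAddCommGroup X] [NormedSpace ℝ X]
    (φ : X → ℝ) (hφ : LocallyLipschitz φ)
    (V : X → X) (hV : LocallyLipschitz V)
    (hpos : ∀ x : X, ∀ xs ∈ clarkeSubdiff φ x, 0 ≤ xs (V x))
    (T : ℝ) (σ : ℝ → X)
    (hσ : ∀ t ∈ Set.Ico (0 : ℝ) T, HasDerivAt σ (-V (σ t)) t) :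
    ∀ s ∈ Set.Ico (0 : ℝ) T, ∀ t ∈ Set.Ico (0 : ℝ) T, s ≤ t → φ (σ t) ≤ φ (σ s) := by
  intro s hs t ht hst
  have hmem : ∀ z ∈ Icc s t, z ∈ Ico 0 T := fun z hz =>
    ⟨hs.1.trans hz.1, hz.2.trans_lt ht.2⟩
  have hnonpos : ∀ x, clarkeDeriv φ x (-V x) ≤ 0 := by
    intro x
    obtain ⟨xs, hxs, heq⟩ := exists_mem_clarkeSubdiff_apply_eq hφ x (-V x)
    rw [← heq, map_neg]
    exact neg_nonpos.2 (hpos x xs hxs)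
  refine image_le_of_liminf_slope_right_le_deriv_boundary (f := φ ∘ σ) (B := fun _ => φ (σ s))
    (B' := 0) (fun z hz => ?_) le_rfl continuousOn_const
    (fun z _ => hasDerivWithinAt_const _ _ _) (fun z hz r hr => ?_) (right_mem_Icc.2 hst)
  · exact (hφ.continuous.continuousAt.comp
      (hσ z (hmem z hz)).continuousAt).continuousWithinAt
  · exact ((hσ z (hmem z (Ico_subset_Icc_self hz))).eventually_slope_lt_of_clarkeDeriv_lt hφ
      ((hnonpos _).trans_lt hr)).frequently

end
end

section
/- Let G ⊆ E be a connected invariant set of descending flow and let D be an invariant set of descending flow which is an open subset of G (in the subspace topology of G). Then ∂_G C_G(D), the boundary of C_G(D) relative to G, is itself invariant under the descending flow: σ(t,v₀) ∈ ∂_G C_G(D) for every v₀ ∈ ∂_G C_G(D) and every t ∈ [0,T₁(v₀)). (Lemma 2.5, part 2) -/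
open Filter Topology Set

noncomputable section

variable {E : Type*} [NormedAddCommGroup E] [NormedSpace ℝ E]

/-- `D` is an invariant set of the descending flow `σ` (with maximal existence times `T₁`). -/
def IsFlowInvariant (σ : E → ℝ → E) (T₁ : E → ENNReal) (D : Set E) : Prop :=
  D.Nonempty ∧ ∀ v ∈ D, ∀ t : ℝ, 0 ≤ t → ENNReal.ofReal t < T₁ v → σ v t ∈ D

/-- `C_G(D) = {v₀ ∈ G : v₀ ∈ D, or σ(t',v₀) ∈ D for some t' ∈ (0, T₁(v₀))}`. -/
def flowCG (σ : E → ℝ → E) (T₁ : E → ENNReal) (G D : Set E) : Set E :=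
  {v ∈ G | v ∈ D ∨ ∃ t : ℝ, 0 < t ∧ ENNReal.ofReal t < T₁ v ∧ σ v t ∈ D}

/-- boundary of `S` relative to the subspace topology of `G` (for `S ⊆ G`). -/
def relBoundary (G S : Set E) : Set E :=
  G ∩ closure S ∩ closure (G \ S)

/-- `σ` is the right-maximal flow of the vector field `-V`, with existence times `T₁`. -/
structure IsMaximalDescendingFlow (V : E → E) (σ : E → ℝ → E) (T₁ : E → ENNReal) : Prop where
  initial : ∀ v : E, σ v 0 = v
  hasDerivAt : ∀ (v : E) (t : ℝ), 0 ≤ t → ENNReal.ofReal t < T₁ v →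
    HasDerivAt (σ v) (-V (σ v t)) t
  maximal : ∀ (v : E) (T' : ℝ) (τ : ℝ → E), τ 0 = v →
    (∀ t ∈ Set.Ico (0 : ℝ) T', HasDerivAt τ (-V (τ t)) t) →
    ENNReal.ofReal T' ≤ T₁ v ∧ ∀ t ∈ Set.Ico (0 : ℝ) T', τ t = σ v t

/-- A locally Lipschitz autonomous vector field satisfies the hypotheses of the
Picard-Lindelöf theorem around every point. -/
lemma LocallyLipschitz.exists_isPicardLindelof {F : Type*} [NormedAddCommGroup F]
    {f : F → F} (hf : LocallyLipschitz f) (x₀ : F) :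
    ∃ (ε : ℝ) (hε : 0 < ε) (a r L K : NNReal), 0 < r ∧
      IsPicardLindelof (fun _ ↦ f) (tmin := -ε) (tmax := ε)
        ⟨0, by simp [hε.le]⟩ x₀ a r L K := by
  obtain ⟨K, s, hs, hl⟩ := hf x₀
  obtain ⟨b, hb, hbs⟩ := Metric.nhds_basis_closedBall.mem_iff.mp hs
  lift b to NNReal using hb.le
  have hb' : (0 : ℝ) < b := hb
  set L : NNReal := K * b + ‖f x₀‖₊ + 1 with hL
  have hL0 : (0 : ℝ) < L := by rw [hL]; push_cast; positivity
  refine ⟨b / 2 / L, by positivity, b, b / 2, L, K, by simpa using hb', ?_⟩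
  refine IsPicardLindelof.of_time_independent (fun x hx ↦ ?_) (hl.mono hbs) ?_
  · have h1 : ‖f x - f x₀‖ ≤ K * ‖x - x₀‖ := hl.norm_sub_le (hbs hx) (mem_of_mem_nhds hs)
    have h2 : (K : ℝ) * ‖x - x₀‖ ≤ K * b := by
      gcongr
      simpa [dist_eq_norm] using hx
    have h3 := norm_le_norm_sub_add (f x) (f x₀)
    simp only [hL, NNReal.coe_add, NNReal.coe_mul, coe_nnnorm, NNReal.coe_one]
    linarith
  · simp only [sub_zero, zero_sub, neg_neg, max_self, NNReal.coe_div, NNReal.coe_ofNat]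
    rw [mul_div_cancel₀ _ hL0.ne']
    linarith

namespace IsMaximalDescendingFlow

variable {V : E → E} {σ : E → ℝ → E} {T₁ : E → ENNReal} {G D : Set E}

/-- For short times the flow is defined near a given point and continuous there. -/
lemma exists_continuousAt [CompleteSpace E] (h : IsMaximalDescendingFlow V σ T₁)
    (hV : LocallyLipschitz V) (v : E) :
    ∃ ε > 0, ∀ s ∈ Icc (0 : ℝ) ε,
      (∀ᶠ u in 𝓝 v, ENNReal.ofReal s < T₁ u) ∧ ContinuousAt (fun u ↦ σ u s) v := by
  have hV' : LocallyLipschitz fun x ↦ -V x := fun x ↦ by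
    obtain ⟨K, s, hs, hl⟩ := hV x
    exact ⟨K, s, hs, hl.neg⟩
  obtain ⟨ε, hε, a, r, L, K, hr, hpl⟩ := hV'.exists_isPicardLindelof v
  obtain ⟨α, hα, L', hL'⟩ :=
    hpl.exists_forall_mem_closedBall_eq_hasDerivWithinAt_lipschitzOnWith
  have hball : Metric.closedBall v r ∈ 𝓝 v := Metric.closedBall_mem_nhds v hr
  have hsol : ∀ u ∈ Metric.closedBall v r,
      ENNReal.ofReal ε ≤ T₁ u ∧ ∀ t ∈ Ico (0 : ℝ) ε, α u t = σ u t := fun u hu ↦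
    h.maximal u ε (α u) (hα u hu).1 fun t ht ↦
      ((hα u hu).2 t ⟨by linarith [ht.1], ht.2.le⟩).hasDerivAt
        (Icc_mem_nhds (by linarith [ht.1]) ht.2)
  refine ⟨ε / 2, half_pos hε, fun s hs ↦ ?_⟩
  have hsε : s < ε := by linarith [hs.2]
  constructor
  · filter_upwards [hball] with u hu
    exact ((ENNReal.ofReal_lt_ofReal_iff hε).2 hsε).trans_le (hsol u hu).1
  · refine ((hL' s ⟨by linarith [hs.1], hsε.le⟩).continuousOn.continuousAt hball).congr ?_
    filter_upwards [hball] with u hu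
    exact (hsol u hu).2 s ⟨hs.1, hsε⟩

lemma existenceTime_pos [CompleteSpace E] (h : IsMaximalDescendingFlow V σ T₁)
    (hV : LocallyLipschitz V) (v : E) : 0 < T₁ v := by
  obtain ⟨ε, hε, hcont⟩ := h.exists_continuousAt hV v
  simpa using (hcont 0 ⟨le_rfl, hε.le⟩).1.self_of_nhds

/-- The semigroup property of the flow. -/
lemma flow_add (h : IsMaximalDescendingFlow V σ T₁) {v : E} {t s : ℝ} (ht : 0 ≤ t) (hs : 0 ≤ s)
    (hts : ENNReal.ofReal (t + s) < T₁ v) :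
    ENNReal.ofReal s < T₁ (σ v t) ∧ σ (σ v t) s = σ v (t + s) := by
  obtain ⟨q, -, hq, hqT⟩ := ENNReal.lt_iff_exists_real_btwn.1 hts
  have hq' : t + s < q := (ENNReal.ofReal_lt_ofReal_iff_of_nonneg (by positivity)).1 hq
  obtain ⟨h1, h2⟩ := h.maximal (σ v t) (q - t) (fun r ↦ σ v (t + r)) (by simp) fun r hr ↦
    (h.hasDerivAt v (t + r) (add_nonneg ht hr.1)
      ((ENNReal.ofReal_le_ofReal (by linarith [hr.2])).trans_lt hqT)).comp_const_add t r
  exact ⟨((ENNReal.ofReal_lt_ofReal_iff_of_nonneg hs).2 (by linarith)).trans_le h1,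
    (h2 s ⟨hs, by linarith⟩).symm⟩

/-- A trajectory may be prolonged by any trajectory issuing from one of its points. -/
lemma add_lt_existenceTime (h : IsMaximalDescendingFlow V σ T₁) {v : E} {t s : ℝ}
    (ht : 0 ≤ t) (hs : 0 ≤ s) (htv : ENNReal.ofReal t < T₁ v)
    (hsv : ENNReal.ofReal s < T₁ (σ v t)) :
    ENNReal.ofReal (t + s) < T₁ v := by
  obtain ⟨q, -, hq, hqT⟩ := ENNReal.lt_iff_exists_real_btwn.1 hsv
  have hq' : s < q := (ENNReal.ofReal_lt_ofReal_iff_of_nonneg hs).1 hq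
  let τ : ℝ → E := fun r ↦ if r ≤ t then σ v r else σ (σ v t) (r - t)
  have hleft : ∀ r ≤ t, τ r = σ v r := fun r hr ↦ if_pos hr
  have hright : ∀ r, t ≤ r → τ r = σ (σ v t) (r - t) := fun r hr ↦ by
    rcases hr.eq_or_lt with rfl | hr
    · simp [τ, h.initial]
    · exact if_neg hr.not_ge
  have hdl : ∀ r, 0 ≤ r → r ≤ t → HasDerivAt (σ v) (-V (τ r)) r := fun r h0 hr ↦ by
    rw [hleft r hr]
    exact h.hasDerivAt v r h0 ((ENNReal.ofReal_le_ofReal hr).trans_lt htv)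
  have hdr : ∀ r, t ≤ r → r < t + q →
      HasDerivAt (fun x ↦ σ (σ v t) (x - t)) (-V (τ r)) r := fun r hr hrq ↦ by
    rw [hright r hr]
    exact (h.hasDerivAt (σ v t) (r - t) (by linarith)
      ((ENNReal.ofReal_le_ofReal (by linarith)).trans_lt hqT)).comp_sub_const r t
  have hτ : ∀ r ∈ Ico (0 : ℝ) (t + q), HasDerivAt τ (-V (τ r)) r := fun r hr ↦ by
    rcases lt_trichotomy r t with hrt | rfl | hrt
    · refine (hdl r hr.1 hrt.le).congr_of_eventuallyEq ?_
      filter_upwards [Iio_mem_nhds hrt] with x hx using hleft x hx.le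
    · have h1 : HasDerivWithinAt τ (-V (τ r)) (Iic r) r :=
        (hdl r hr.1 le_rfl).hasDerivWithinAt.congr hleft (hleft r le_rfl)
      have h2 : HasDerivWithinAt τ (-V (τ r)) (Ici r) r :=
        (hdr r le_rfl hr.2).hasDerivWithinAt.congr hright (hright r le_rfl)
      simpa [Iic_union_Ici] using h1.union h2
    · refine (hdr r hrt.le hr.2).congr_of_eventuallyEq ?_
      filter_upwards [Ioi_mem_nhds hrt] with x hx using hright x (le_of_lt hx)
  have hmax := (h.maximal v (t + q) τ ((hleft 0 ht).trans (h.initial v)) hτ).1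
  exact ((ENNReal.ofReal_lt_ofReal_iff_of_nonneg (by positivity)).2 (by linarith)).trans_le hmax

lemma mem_flowCG_iff [CompleteSpace E] (h : IsMaximalDescendingFlow V σ T₁)
    (hV : LocallyLipschitz V) {v : E} :
    v ∈ flowCG σ T₁ G D ↔
      v ∈ G ∧ ∃ t : ℝ, 0 ≤ t ∧ ENNReal.ofReal t < T₁ v ∧ σ v t ∈ D := by
  refine and_congr_right fun _ ↦ ⟨?_, ?_⟩
  · rintro (hv | ⟨t, ht, htv, hD⟩)
    · exact ⟨0, le_rfl, by simpa using h.existenceTime_pos hV v, by rwa [h.initial]⟩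
    · exact ⟨t, ht.le, htv, hD⟩
  · rintro ⟨t, ht, htv, hD⟩
    rcases ht.eq_or_lt with rfl | ht
    · exact .inl (by rwa [h.initial] at hD)
    · exact .inr ⟨t, ht, htv, hD⟩

/-- A point of `G` belongs to `C_G(D)` if and only if its trajectory does. -/
lemma flow_mem_flowCG_iff [CompleteSpace E] (h : IsMaximalDescendingFlow V σ T₁)
    (hV : LocallyLipschitz V) (hG : IsFlowInvariant σ T₁ G) (hD : IsFlowInvariant σ T₁ D)
    {v : E} (hv : v ∈ G) {t : ℝ} (ht : 0 ≤ t) (htv : ENNReal.ofReal t < T₁ v) :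
    σ v t ∈ flowCG σ T₁ G D ↔ v ∈ flowCG σ T₁ G D := by
  simp only [h.mem_flowCG_iff hV, hv, hG.2 v hv t ht htv, true_and]
  constructor
  · rintro ⟨s, hs, hsv, hsD⟩
    have hts := h.add_lt_existenceTime ht hs htv hsv
    exact ⟨t + s, by positivity, hts, (h.flow_add ht hs hts).2 ▸ hsD⟩
  · rintro ⟨s, hs, hsv, hsD⟩
    rcases le_total t s with hts | hts
    · obtain ⟨h1, h2⟩ := h.flow_add (v := v) ht (sub_nonneg.2 hts) (by simpa using hsv)
      exact ⟨s - t, sub_nonneg.2 hts, h1, by simpa [h2] using hsD⟩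
    · obtain ⟨h1, h2⟩ := h.flow_add (v := v) hs (sub_nonneg.2 hts) (by simpa using htv)
      refine ⟨0, le_rfl, by simpa using h.existenceTime_pos hV _, ?_⟩
      have := hD.2 _ hsD _ (sub_nonneg.2 hts) h1
      rw [h2, add_sub_cancel] at this
      rwa [h.initial]

/-- The relative boundary of `C_G(D)` is invariant for short times. -/
lemma exists_flow_mem_relBoundary [CompleteSpace E] (h : IsMaximalDescendingFlow V σ T₁)
    (hV : LocallyLipschitz V) (hG : IsFlowInvariant σ T₁ G) (hD : IsFlowInvariant σ T₁ D)
    {v : E} (hv : v ∈ relBoundary G (flowCG σ T₁ G D)) :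
    ∃ ε > 0, ∀ s ∈ Icc (0 : ℝ) ε, σ v s ∈ relBoundary G (flowCG σ T₁ G D) := by
  obtain ⟨ε, hε, hcont⟩ := h.exists_continuousAt hV v
  refine ⟨ε, hε, fun s hs ↦ ?_⟩
  obtain ⟨hT, hc⟩ := hcont s hs
  have hclosure : ∀ {S : Set E}, v ∈ closure S →
      (∀ u ∈ S, ENNReal.ofReal s < T₁ u → σ u s ∈ S) → σ v s ∈ closure S := fun hvS hS ↦ by
    rw [mem_closure_iff_frequently] at hvS ⊢
    exact hc.tendsto.frequently ((hvS.and_eventually hT).mono fun u hu ↦ hS u hu.1 hu.2)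
  refine ⟨⟨hG.2 v hv.1.1 s hs.1 hT.self_of_nhds, hclosure hv.1.2 fun u hu huT ↦ ?_⟩,
    hclosure hv.2 fun u hu huT ↦ ⟨hG.2 u hu.1 s hs.1 huT, ?_⟩⟩
  · exact (h.flow_mem_flowCG_iff hV hG hD hu.1 hs.1 huT).2 hu
  · exact fun hmem ↦ hu.2 ((h.flow_mem_flowCG_iff hV hG hD hu.1 hs.1 huT).1 hmem)

end IsMaximalDescendingFlow

/-- **Lemma 2.5, part 2.** The boundary of `C_G(D)` relative to `G` is itself invariant
under the descending flow. -/
theorem lemma_2_5_part2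
    {E : Type*} [NormedAddCommGroup E] [NormedSpace ℝ E] [CompleteSpace E]
    (V : E → E) (hV : LocallyLipschitz V)
    (σ : E → ℝ → E) (T₁ : E → ENNReal)
    (hσ0 : ∀ v : E, σ v 0 = v)
    (hσderiv : ∀ (v : E) (t : ℝ), 0 ≤ t → ENNReal.ofReal t < T₁ v →
      HasDerivAt (σ v) (-V (σ v t)) t)
    (hσmax : ∀ (v : E) (T' : ℝ) (τ : ℝ → E), τ 0 = v →
      (∀ t ∈ Set.Ico (0 : ℝ) T', HasDerivAt τ (-V (τ t)) t) →
      ENNReal.ofReal T' ≤ T₁ v ∧ ∀ t ∈ Set.Ico (0 : ℝ) T', τ t = σ v t)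
    (G D : Set E)
    (hG : IsFlowInvariant σ T₁ G) (hGconn : IsConnected G)
    (hD : IsFlowInvariant σ T₁ D) (hDG : D ⊆ G)
    (hDopen : ∃ U : Set E, IsOpen U ∧ D = U ∩ G) :
    ∀ v ∈ relBoundary G (flowCG σ T₁ G D), ∀ t : ℝ, 0 ≤ t →
      ENNReal.ofReal t < T₁ v → σ v t ∈ relBoundary G (flowCG σ T₁ G D) := by
  intro v hv t ht htv
  have h : IsMaximalDescendingFlow V σ T₁ := ⟨hσ0, hσderiv, hσmax⟩
  have hT : ∀ r ≤ t, ENNReal.ofReal r < T₁ v := fun r hr ↦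
    (ENNReal.ofReal_le_ofReal hr).trans_lt htv
  have hcont : ContinuousOn (σ v) (Icc 0 t) := fun r hr ↦
    (hσderiv v r hr.1 (hT r hr.2)).continuousAt.continuousWithinAt
  have hclosed : IsClosed (σ v ⁻¹' relBoundary G (flowCG σ T₁ G D) ∩ Icc 0 t) := by
    convert hcont.preimage_isClosed_of_isClosed isClosed_Icc
      ((isClosed_closure (s := flowCG σ T₁ G D)).inter
        (isClosed_closure (s := G \ flowCG σ T₁ G D))) using 1
    ext r
    refine ⟨fun hr ↦ ⟨hr.2, hr.1.1.2, hr.1.2⟩, fun hr ↦ ⟨⟨⟨?_, hr.2.1⟩, hr.2.2⟩, hr.1⟩⟩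
    exact hG.2 v hv.1.1 r hr.1.1 (hT r hr.1.2)
  refine hclosed.mem_of_ge_of_forall_exists_gt (by rwa [mem_preimage, hσ0]) ht fun r hr ↦ ?_
  obtain ⟨ε, hε, hflow⟩ := h.exists_flow_mem_relBoundary hV hG hD hr.1
  have hs : 0 < min ε (t - r) := lt_min hε (sub_pos.2 hr.2.2)
  have hle : r + min ε (t - r) ≤ t := by linarith [min_le_right ε (t - r)]
  refine ⟨r + min ε (t - r), ?_, by linarith, hle⟩
  rw [mem_preimage, ← (h.flow_add hr.2.1 hs.le (hT _ hle)).2]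
  exact hflow _ ⟨hs.le, min_le_left _ _⟩

end
end

section
/- Let X be a real reflexive Banach space, C ⊆ X a nonempty, non-singleton, closed convex set, and φ : X → ℝ locally Lipschitz. If ∂φ is outwardly directed on ∂C, or if φ satisfies the Schauder invariance condition (I−∇φ)(C) ⊆ C, then for every x ∈ C: m_C(x) = 0 if and only if m(x) = 0. (Lemma 2.1) -/
open Filter Topology Set

noncomputable section

variable {X : Type*} [NormedAddCommGroup X] [NormedSpace ℝ X]

/-- `m(x) = inf {‖x*‖ : x* ∈ ∂φ(x)}`. -/
def mSlope (φ : X → ℝ) (x : X) : ℝ :=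
  sInf {r | ∃ xs ∈ clarkeSubdiff φ x, r = ‖xs‖}

/-- `m_C(x)`. -/
def mCSlope (φ : X → ℝ) (C : Set X) (x : X) : ℝ :=
  sInf {r | ∃ xs ∈ clarkeSubdiff φ x,
    r = sSup {s | ∃ y ∈ C, ‖x - y‖ < 1 ∧ s = xs (x - y)}}

/-- the nonsmooth (CPS)-condition on the whole space. -/
def CPS (φ : X → ℝ) : Prop :=
  ∀ x : ℕ → X, (∃ M : ℝ, ∀ n, |φ (x n)| ≤ M) →
    Tendsto (fun n => (1 + ‖x n‖) * mSlope φ (x n)) atTop (𝓝 0) →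
    ∃ z : X, ∃ s : ℕ → ℕ, StrictMono s ∧ Tendsto (fun n => x (s n)) atTop (𝓝 z)

/-- the nonsmooth (CPS)_D-condition on a set D. -/
def CPSOn (φ : X → ℝ) (D : Set X) : Prop :=
  ∀ x : ℕ → X, (∀ n, x n ∈ D) → (∃ M : ℝ, ∀ n, |φ (x n)| ≤ M) →
    Tendsto (fun n => (1 + ‖x n‖) * mCSlope φ D (x n)) atTop (𝓝 0) →
    ∃ z : X, ∃ s : ℕ → ℕ, StrictMono s ∧ Tendsto (fun n => x (s n)) atTop (𝓝 z)

/-- the (PS)-condition. -/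
def PSCond (φ : X → ℝ) : Prop :=
  ∀ x : ℕ → X, (∃ M : ℝ, ∀ n, |φ (x n)| ≤ M) →
    Tendsto (fun n => mSlope φ (x n)) atTop (𝓝 0) →
    ∃ z : X, ∃ s : ℕ → ℕ, StrictMono s ∧ Tendsto (fun n => x (s n)) atTop (𝓝 z)

/-- duality map F(x*). -/
def dualityMap (xs : X →L[ℝ] ℝ) : Set X :=
  {x | xs x = ‖xs‖ ^ 2 ∧ ‖x‖ ^ 2 = ‖xs‖ ^ 2}

/-- `∇φ(x) = F(∂φ(x))`. -/
def clarkeGrad (φ : X → ℝ) (x : X) : Set X :=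
  ⋃ xs ∈ clarkeSubdiff φ x, dualityMap xs

/-- normal cone to a convex set. -/
def normalCone (C : Set X) (x : X) : Set (X →L[ℝ] ℝ) :=
  {xs | ∀ z ∈ C, xs (z - x) ≤ 0}

/-- `∂φ` outwardly directed on `∂C`. -/
def OutwardlyDirected (φ : X → ℝ) (C : Set X) : Prop :=
  ∀ x ∈ frontier C, ∀ xs ∈ clarkeSubdiff φ x, -xs ∈ normalCone C x → xs = 0

/-- Schauder invariance condition `(I - ∇φ)(C) ⊆ C`. -/
def SchauderInv (φ : X → ℝ) (C : Set X) : Prop :=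
  ∀ x ∈ C, ∀ w ∈ clarkeGrad φ x, x - w ∈ C

/-- Reflexivity of a normed space. -/
def ReflexiveSpace (X : Type*) [NormedAddCommGroup X] [NormedSpace ℝ X] : Prop :=
  Function.Surjective (NormedSpace.inclusionInDoubleDual ℝ X)

/-- Locally Lipschitz on a set. -/
def LocLipOn {α β : Type*} [PseudoMetricSpace α] [PseudoMetricSpace β]
    (f : α → β) (s : Set α) : Prop :=
  ∀ x ∈ s, ∃ K : NNReal, ∃ t ∈ 𝓝[s] x, LipschitzOnWith K f t


theorem clarkeDeriv_le_of_locallyLipschitz {φ : X → ℝ} (hφ : LocallyLipschitz φ) (x : X) :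
    ∃ K : ℝ, ∀ h, clarkeDeriv φ x h ≤ K * ‖h‖ := by
  obtain ⟨K, t, ht, hK⟩ := hφ x
  refine ⟨K, fun h => ?_⟩
  have hfst : Tendsto (fun p : X × ℝ => p.1) (𝓝 x ×ˢ 𝓝[>] (0 : ℝ)) (𝓝 x) := tendsto_fst
  have hsnd : Tendsto (fun p : X × ℝ => p.2) (𝓝 x ×ˢ 𝓝[>] (0 : ℝ)) (𝓝[>] 0) := tendsto_snd
  have hadd : Tendsto (fun p : X × ℝ => p.1 + p.2 • h) (𝓝 x ×ˢ 𝓝[>] (0 : ℝ)) (𝓝 x) := by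
    simpa using hfst.add ((hsnd.mono_right nhdsWithin_le_nhds).smul_const h)
  have habs : ∀ᶠ p : X × ℝ in 𝓝 x ×ˢ 𝓝[>] (0 : ℝ),
      |(φ (p.1 + p.2 • h) - φ p.1) / p.2| ≤ K * ‖h‖ := by
    filter_upwards [hfst ht, hadd ht, hsnd self_mem_nhdsWithin] with p h1 h2 h3
    have h3 : 0 < p.2 := h3
    have hd := hK.dist_le_mul _ h2 _ h1
    rw [Real.dist_eq, dist_eq_norm, add_sub_cancel_left, norm_smul, Real.norm_of_nonneg h3.le] at hd
    rw [abs_div, abs_of_pos h3, div_le_iff₀ h3]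
    linarith
  refine limsup_le_of_le (IsCoboundedUnder.of_frequently_ge (a := -(K * ‖h‖)) ?_)
    (habs.mono fun p hp => (abs_le.1 hp).2)
  exact (habs.mono fun p hp => (abs_le.1 hp).1).frequently

theorem norm_le_of_forall_le_mul_norm {xs : X →L[ℝ] ℝ} {K : ℝ} (hK : ∀ h, xs h ≤ K * ‖h‖) :
    ‖xs‖ ≤ max K 0 := by
  refine xs.opNorm_le_bound (le_max_right _ _) fun h => ?_
  have h1 := hK h
  have h2 := hK (-h)
  rw [map_neg, norm_neg] at h2
  have h3 : K * ‖h‖ ≤ max K 0 * ‖h‖ := by gcongr; exact le_max_left _ _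
  rw [Real.norm_eq_abs, abs_le]
  constructor <;> linarith

/-- The Clarke subdifferential is weak-* compact. -/
theorem isCompact_clarkeSubdiff {φ : X → ℝ} (hφ : LocallyLipschitz φ) (x : X) :
    IsCompact (WeakDual.toStrongDual ⁻¹' clarkeSubdiff φ x) := by
  obtain ⟨K, hK⟩ := clarkeDeriv_le_of_locallyLipschitz hφ x
  refine (WeakDual.isCompact_closedBall (𝕜 := ℝ) (E := X) 0 (max K 0)).of_isClosed_subset ?_ ?_
  · have : (WeakDual.toStrongDual ⁻¹' clarkeSubdiff φ x : Set (WeakDual ℝ X)) =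
        ⋂ h, {f | f h ≤ clarkeDeriv φ x h} := by
      ext f
      simp [clarkeSubdiff]
    rw [this]
    exact isClosed_iInter fun h => isClosed_le (WeakDual.eval_continuous h) continuous_const
  · intro f hf
    rw [mem_preimage, mem_closedBall_zero_iff]
    exact norm_le_of_forall_le_mul_norm fun h => (hf h).trans (hK h)

theorem le_norm_of_mem_localDifferences {C : Set X} {x : X} {xs : X →L[ℝ] ℝ} {s : ℝ}
    (hs : s ∈ {s | ∃ y ∈ C, ‖x - y‖ < 1 ∧ s = xs (x - y)}) : s ≤ ‖xs‖ := by
  obtain ⟨y, -, hy, rfl⟩ := hs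
  calc xs (x - y) ≤ ‖xs (x - y)‖ := le_abs_self _
    _ ≤ ‖xs‖ * ‖x - y‖ := xs.le_opNorm _
    _ ≤ ‖xs‖ := mul_le_of_le_one_right (norm_nonneg _) hy.le

theorem bddAbove_localDifferences (C : Set X) (x : X) (xs : X →L[ℝ] ℝ) :
    BddAbove {s | ∃ y ∈ C, ‖x - y‖ < 1 ∧ s = xs (x - y)} :=
  ⟨‖xs‖, fun _ => le_norm_of_mem_localDifferences⟩

theorem sSup_localDifferences_nonneg {C : Set X} {x : X} (hx : x ∈ C) (xs : X →L[ℝ] ℝ) :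
    0 ≤ sSup {s | ∃ y ∈ C, ‖x - y‖ < 1 ∧ s = xs (x - y)} :=
  le_csSup (bddAbove_localDifferences C x xs) ⟨x, hx, by simp, by simp⟩

theorem sSup_localDifferences_le_norm {C : Set X} {x : X} (hx : x ∈ C) (xs : X →L[ℝ] ℝ) :
    sSup {s | ∃ y ∈ C, ‖x - y‖ < 1 ∧ s = xs (x - y)} ≤ ‖xs‖ :=
  csSup_le ⟨_, x, hx, by simp, rfl⟩ fun _ => le_norm_of_mem_localDifferences

theorem mCSlope_nonneg {φ : X → ℝ} {C : Set X} {x : X} (hx : x ∈ C) : 0 ≤ mCSlope φ C x := by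
  refine Real.sInf_nonneg ?_
  rintro _ ⟨xs, -, rfl⟩
  exact sSup_localDifferences_nonneg hx xs

theorem mCSlope_le_mSlope {φ : X → ℝ} {C : Set X} {x : X} (hx : x ∈ C)
    (hne : (clarkeSubdiff φ x).Nonempty) : mCSlope φ C x ≤ mSlope φ x := by
  obtain ⟨xs₀, hxs₀⟩ := hne
  refine le_csInf ⟨_, xs₀, hxs₀, rfl⟩ ?_
  rintro _ ⟨xs, hxs, rfl⟩
  have hle : mCSlope φ C x ≤ sSup {s | ∃ y ∈ C, ‖x - y‖ < 1 ∧ s = xs (x - y)} := by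
    refine csInf_le ⟨0, ?_⟩ ⟨xs, hxs, rfl⟩
    rintro _ ⟨ys, -, rfl⟩
    exact sSup_localDifferences_nonneg hx ys
  exact hle.trans (sSup_localDifferences_le_norm hx xs)

theorem mSlope_eq_zero_of_zero_mem {φ : X → ℝ} {x : X} (h : 0 ∈ clarkeSubdiff φ x) :
    mSlope φ x = 0 := by
  have hlb : ∀ r ∈ {r | ∃ xs ∈ clarkeSubdiff φ x, r = ‖xs‖}, 0 ≤ r := by
    rintro _ ⟨xs, -, rfl⟩
    exact norm_nonneg xs
  have hmem : (0 : ℝ) ∈ {r | ∃ xs ∈ clarkeSubdiff φ x, r = ‖xs‖} := ⟨0, h, norm_zero.symm⟩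
  exact le_antisymm (csInf_le ⟨0, hlb⟩ hmem) (Real.sInf_nonneg hlb)

/-- For convex sets, the normal cone is determined by nearby points. -/
theorem neg_mem_normalCone_of_local {C : Set X} (hC : Convex ℝ C) {x : X} (hx : x ∈ C)
    {xs : X →L[ℝ] ℝ} (h : ∀ y ∈ C, ‖x - y‖ < 1 → xs (x - y) ≤ 0) :
    -xs ∈ normalCone C x := by
  intro z hz
  set t : ℝ := (1 + ‖x - z‖)⁻¹ with ht
  have hpos : 0 < 1 + ‖x - z‖ := by positivity
  have ht0 : 0 < t := inv_pos.2 hpos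
  have ht1 : t ≤ 1 := inv_le_one_of_one_le₀ (by linarith [norm_nonneg (x - z)])
  have hsub : x - (x + t • (z - x)) = t • (x - z) := by module
  have hle := h _ (hC.add_smul_sub_mem hx hz ⟨ht0.le, ht1⟩) (by
    rw [hsub, norm_smul, Real.norm_of_nonneg ht0.le, ht, inv_mul_lt_one₀ hpos]
    linarith)
  rw [hsub, map_smul, smul_eq_mul] at hle
  have := nonpos_of_mul_nonpos_right hle ht0
  rw [map_sub] at this
  simpa using this

/-- If `m_C(x) = 0`, then weak-* compactness yields a subgradient attaining the infimum. -/
theorem exists_neg_mem_normalCone_of_mCSlope_eq_zero {φ : X → ℝ} (hφ : LocallyLipschitz φ)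
    {C : Set X} (hC : Convex ℝ C) {x : X} (hx : x ∈ C) (hne : (clarkeSubdiff φ x).Nonempty)
    (h0 : mCSlope φ C x = 0) : ∃ xs ∈ clarkeSubdiff φ x, -xs ∈ normalCone C x := by
  let A : ℕ → Set (WeakDual ℝ X) := fun n => WeakDual.toStrongDual ⁻¹' clarkeSubdiff φ x ∩
    {f | ∀ y ∈ C, ‖x - y‖ < 1 → f (x - y) ≤ 1 / ((n : ℝ) + 1)}
  have hclosed : ∀ n, IsClosed
      {f : WeakDual ℝ X | ∀ y ∈ C, ‖x - y‖ < 1 → f (x - y) ≤ 1 / ((n : ℝ) + 1)} := by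
    intro n
    simp only [ofPred_forall]
    exact isClosed_iInter fun y => isClosed_iInter fun _ => isClosed_iInter fun _ =>
      isClosed_le (WeakDual.eval_continuous _) continuous_const
  have hcompact : ∀ n, IsCompact (A n) := fun n =>
    (isCompact_clarkeSubdiff hφ x).inter_right (hclosed n)
  have hA : (⋂ n, A n).Nonempty := by
    refine IsCompact.nonempty_iInter_of_sequence_nonempty_isCompact_isClosed A ?_ ?_ (hcompact 0)
      fun n => (isCompact_clarkeSubdiff hφ x).isClosed.inter (hclosed n)
    · rintro n f ⟨hf, hfn⟩
      refine ⟨hf, fun y hy hxy => (hfn y hy hxy).trans ?_⟩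
      push_cast
      gcongr
      linarith
    · intro n
      obtain ⟨xs₀, hxs₀⟩ := hne
      obtain ⟨_, ⟨xs, hxs, rfl⟩, hlt⟩ := exists_lt_of_csInf_lt
        (s := {r | ∃ xs ∈ clarkeSubdiff φ x,
          r = sSup {s | ∃ y ∈ C, ‖x - y‖ < 1 ∧ s = xs (x - y)}}) ⟨_, xs₀, hxs₀, rfl⟩
        (h0.trans_lt (Nat.one_div_pos_of_nat (α := ℝ) (n := n)))
      exact ⟨StrongDual.toWeakDual xs, hxs, fun y hy hxy =>
        (le_csSup (bddAbove_localDifferences C x xs) ⟨y, hy, hxy, rfl⟩).trans hlt.le⟩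
  obtain ⟨f, hf⟩ := hA
  rw [mem_iInter] at hf
  refine ⟨WeakDual.toStrongDual f, (hf 0).1, neg_mem_normalCone_of_local hC hx
    fun y hy hxy => ?_⟩
  exact ge_of_tendsto' (tendsto_one_div_add_atTop_nhds_zero_nat (𝕜 := ℝ))
    fun n => (hf n).2 y hy hxy

theorem dualityMap_nonempty (hrefl : ReflexiveSpace X) (xs : X →L[ℝ] ℝ) :
    (dualityMap xs).Nonempty := by
  obtain ⟨g, hg, hgxs⟩ := exists_dual_vector'' ℝ xs
  obtain ⟨w, rfl⟩ := hrefl g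
  have hw : ‖w‖ ≤ 1 := by
    rwa [← (NormedSpace.inclusionInDoubleDualLi ℝ (E := X)).norm_map w]
  have hxw : xs w = ‖xs‖ := by simpa using hgxs
  refine ⟨‖xs‖ • w, ?_, ?_⟩
  · rw [map_smul, hxw, smul_eq_mul, sq]
  · have h := xs.le_opNorm w
    rw [hxw, norm_norm] at h
    rw [norm_smul, norm_norm, le_antisymm (mul_le_of_le_one_right (norm_nonneg _) hw) h]

theorem eq_zero_of_neg_mem_normalCone_of_mem_interior {C : Set X} {x : X} (hx : x ∈ interior C)
    {xs : X →L[ℝ] ℝ} (h : -xs ∈ normalCone C x) : xs = 0 := by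
  have hloc : IsLocalMin xs x := by
    filter_upwards [mem_interior_iff_mem_nhds.1 hx] with z hz
    simpa using h z hz
  exact hloc.hasFDerivAt_eq_zero xs.hasFDerivAt

theorem OutwardlyDirected.eq_zero {φ : X → ℝ} {C : Set X} (h : OutwardlyDirected φ C) {x : X}
    (hx : x ∈ C) {xs : X →L[ℝ] ℝ} (hxs : xs ∈ clarkeSubdiff φ x)
    (hn : -xs ∈ normalCone C x) : xs = 0 := by
  by_cases hi : x ∈ interior C
  · exact eq_zero_of_neg_mem_normalCone_of_mem_interior hi hn
  · exact h x ⟨subset_closure hx, hi⟩ xs hxs hn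

theorem SchauderInv.eq_zero (hrefl : ReflexiveSpace X) {φ : X → ℝ} {C : Set X}
    (h : SchauderInv φ C) {x : X} (hx : x ∈ C) {xs : X →L[ℝ] ℝ} (hxs : xs ∈ clarkeSubdiff φ x)
    (hn : -xs ∈ normalCone C x) : xs = 0 := by
  obtain ⟨w, hw⟩ := dualityMap_nonempty hrefl xs
  have hle := hn _ (h x hx w (mem_biUnion hxs hw))
  have hsq : ‖xs‖ ^ 2 ≤ 0 := by
    rw [← hw.1]
    simpa using hle
  exact norm_eq_zero.1 (pow_eq_zero_iff two_ne_zero |>.1 (le_antisymm hsq (sq_nonneg _)))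

/-- **Lemma 2.1.** If `∂φ` is outwardly directed on `∂C`, or `φ` satisfies the Schauder
invariance condition on `C`, then for `x ∈ C`: `m_C(x) = 0 ↔ m(x) = 0`. -/
theorem lemma_2_1
    {X : Type*} [NormedAddCommGroup X] [NormedSpace ℝ X]
    (hrefl : ReflexiveSpace X)
    (C : Set X) (hCnt : C.Nontrivial) (hCcl : IsClosed C) (hCconv : Convex ℝ C)
    (φ : X → ℝ) (hφ : LocallyLipschitz φ)
    (hcond : OutwardlyDirected φ C ∨ SchauderInv φ C) :
    ∀ x ∈ C, (mCSlope φ C x = 0 ↔ mSlope φ x = 0) := by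
  intro x hx
  rcases (clarkeSubdiff φ x).eq_empty_or_nonempty with he | hne
  · simp [mCSlope, mSlope, he]
  refine ⟨fun h0 => ?_, fun h0 =>
    le_antisymm ((mCSlope_le_mSlope hx hne).trans_eq h0) (mCSlope_nonneg hx)⟩
  obtain ⟨xs, hxs, hn⟩ := exists_neg_mem_normalCone_of_mCSlope_eq_zero hφ hCconv hx hne h0
  have hzero : xs = 0 := hcond.elim (fun h => h.eq_zero hx hxs hn)
    fun h => h.eq_zero hrefl hx hxs hn
  exact mSlope_eq_zero_of_zero_mem (hzero ▸ hxs)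

end
end
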